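/- Let n ≥ 2, q > 1, p ∈ ℝ, let Ω be a convex body in ℝⁿ containing the origin in its interior, let u be a q-torsion function of Ω, and let ν : ∂Ω → S^{n-1} be a measurable map such that ⟨y, ν(y)⟩ = h_Ω(ν(y)) for H^{n-1}-a.e. y ∈ ∂Ω (a Gauss map of Ω). Then for every Borel set η ⊆ S^{n-1}, Q̃_{q,n-p}(Ω,η) = ((q-1)/(n(q-1)+q)) ∫_{ν^{-1}(η)} ⟨y, ν(y)⟩ ‖y‖^{p-n} ‖∇u(y)‖^q dH^{n-1}(y). -/

import Mathlib

open MeasureTheory Metric Filter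
open scoped InnerProductSpace ENNReal Topology

/-- The support function of a set `K`: `h_K(x) = sup_{y ∈ K} ⟪x, y⟫`. -/
noncomputable def suppFn {n : ℕ} (K : Set (EuclideanSpace ℝ (Fin n)))
    (x : EuclideanSpace ℝ (Fin n)) : ℝ :=
  sSup ((fun y => ⟪x, y⟫_ℝ) '' K)

/-- The radial function of a set `K`: `ρ_K(v) = max {c > 0 : c • v ∈ K}`. -/
noncomputable def radFn {n : ℕ} (K : Set (EuclideanSpace ℝ (Fin n)))
    (v : EuclideanSpace ℝ (Fin n)) : ℝ :=
  sSup {c : ℝ | 0 < c ∧ c • v ∈ K}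


/-- `u` is a `q`-torsion function of the convex body `Ω`, with (continuous extension of the)
gradient `G`: `u` is continuous on `Ω`, vanishes on `∂Ω`, is positive on the interior,
has gradient `G` on the interior, `G` is continuous on `Ω`, and `Δ_q u = -1` weakly. -/
structure IsQTorsion {n : ℕ} (q : ℝ) (Ω : Set (EuclideanSpace ℝ (Fin n)))
    (u : EuclideanSpace ℝ (Fin n) → ℝ)
    (G : EuclideanSpace ℝ (Fin n) → EuclideanSpace ℝ (Fin n)) : Prop where
  contOn : ContinuousOn u Ω
  zero_on_bdry : ∀ y ∈ frontier Ω, u y = 0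
  pos_on_int : ∀ y ∈ interior Ω, 0 < u y
  grad_on_int : ∀ y ∈ interior Ω, HasGradientAt u (G y) y
  grad_cont : ContinuousOn G Ω
  weak_sol : ∀ φ : EuclideanSpace ℝ (Fin n) → ℝ, ContDiff ℝ (⊤ : ℕ∞) φ → HasCompactSupport φ →
    tsupport φ ⊆ interior Ω →
    ∫ y in interior Ω, ‖G y‖ ^ (q - 2) * ⟪G y, gradient φ y⟫_ℝ = ∫ y in interior Ω, φ y

/-- The spherical Lebesgue measure `σ` on `S^{n-1}`: the `(n-1)`-dimensional Hausdorff
measure restricted to the unit sphere. -/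
noncomputable def sphLeb (n : ℕ) : Measure (EuclideanSpace ℝ (Fin n)) :=
  (μH[(n : ℝ) - 1]).restrict (sphere (0 : EuclideanSpace ℝ (Fin n)) 1)

/-- The reverse radial Gauss image of `η ⊆ S^{n-1}` with respect to `Ω`:
`α*_Ω(η) = {v ∈ S^{n-1} : ∃ ξ ∈ η, ρ_Ω(v)⟪v,ξ⟫ = h_Ω(ξ)}`. -/
def revRadGauss {n : ℕ} (Ω η : Set (EuclideanSpace ℝ (Fin n))) :
    Set (EuclideanSpace ℝ (Fin n)) :=
  {v | v ∈ sphere (0 : EuclideanSpace ℝ (Fin n)) 1 ∧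
    ∃ ξ ∈ η, radFn Ω v * ⟪v, ξ⟫_ℝ = suppFn Ω ξ}

/-- The `p`-th dual `q`-torsional measure of `Ω` (with torsion gradient `G`) evaluated on `η`:
`Q̃_{q,n-p}(Ω,η) = ((q-1)/(n(q-1)+q)) ∫_{α*_Ω(η)} ρ_Ω(v)^p ‖∇u(ρ_Ω(v)v)‖^q dσ(v)`. -/
noncomputable def dualTorsMeas {n : ℕ} (q p : ℝ) (Ω : Set (EuclideanSpace ℝ (Fin n)))
    (G : EuclideanSpace ℝ (Fin n) → EuclideanSpace ℝ (Fin n))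
    (η : Set (EuclideanSpace ℝ (Fin n))) : ℝ :=
  ((q - 1) / (n * (q - 1) + q)) *
    ∫ v in revRadGauss Ω η, (radFn Ω v) ^ p * ‖G (radFn Ω v • v)‖ ^ q ∂(sphLeb n)


noncomputable def coneC (n : ℕ) : ℝ≥0∞ :=
  (Measure.addHaarScalarFactor (volume : Measure (EuclideanSpace ℝ (Fin (n-1)))) μH[((n-1 : ℕ) : ℝ)] : ℝ≥0∞)
    * ∫⁻ x in Set.Ioc (0:ℝ) 1, ENNReal.ofReal (x ^ (n-1))

lemma coneC_ne_zero (n : ℕ) : coneC n ≠ 0 := by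
  unfold coneC
  refine mul_ne_zero ?_ ?_
  · exact_mod_cast Measure.addHaarScalarFactor_volume_hausdorffMeasure_ne_zero (n-1)
  · rw [← pos_iff_ne_zero, setLIntegral_pos_iff (by fun_prop)]
    have : Function.support (fun x : ℝ => ENNReal.ofReal (x ^ (n-1))) ∩ Set.Ioc 0 1 = Set.Ioc 0 1 := by
      apply Set.inter_eq_right.2
      intro x hx
      simp only [Function.mem_support, ne_eq, ENNReal.ofReal_eq_zero, not_le]
      exact pow_pos hx.1 _
    rw [this]; simp

lemma coneC_ne_top (n : ℕ) : coneC n ≠ ∞ := by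
  unfold coneC
  refine ENNReal.mul_ne_top (by simp) (ne_of_lt ?_)
  calc _ ≤ ∫⁻ x in Set.Ioc (0:ℝ) 1, 1 := by
        refine setLIntegral_mono' measurableSet_Ioc (fun x hx => ?_)
        rw [ENNReal.ofReal_le_one]
        exact pow_le_one₀ hx.1.le hx.2
    _ < ∞ := by simp

lemma cone_vol {n : ℕ} (hn : 1 ≤ n) (ξ : EuclideanSpace ℝ (Fin n)) (hξ : ξ ≠ 0)
    (Z : Set (EuclideanSpace ℝ (Fin n))) (hZ : MeasurableSet Z) (hZ1 : ∀ z ∈ Z, ⟪ξ, z⟫_ℝ = 1) :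
    ‖ξ‖ₑ * volume {x | 0 < ⟪ξ, x⟫_ℝ ∧ ⟪ξ, x⟫_ℝ ≤ 1 ∧ (⟪ξ, x⟫_ℝ)⁻¹ • x ∈ Z}
      = coneC n * μH[(n:ℝ) - 1] Z := by
  have hT : MeasurableSet {x | 0 < ⟪ξ, x⟫_ℝ ∧ ⟪ξ, x⟫_ℝ ≤ 1 ∧ (⟪ξ, x⟫_ℝ)⁻¹ • x ∈ Z} := by
    have h1 : Measurable fun x : EuclideanSpace ℝ (Fin n) => ⟪ξ, x⟫_ℝ := by fun_prop
    have h2 : Measurable fun x : EuclideanSpace ℝ (Fin n) => (⟪ξ, x⟫_ℝ)⁻¹ • x := by fun_prop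
    exact (measurableSet_lt measurable_const h1).inter
      ((measurableSet_le h1 measurable_const).inter (h2 hZ))
  have hnξ : ‖ξ‖ ≠ 0 := norm_ne_zero_iff.2 hξ
  have hv : (‖ξ‖^2)⁻¹ • ξ ≠ 0 := smul_ne_zero (by positivity) hξ
  have key := EuclideanGeometry.euclideanHausdorffMeasure_eq_lintegral
    (0 : EuclideanSpace ℝ (Fin n)) hv hT
  rw [InnerProductSpace.euclideanHausdorffMeasure_eq_volume, finrank_euclideanSpace_fin] at key
  rw [key, ← mul_assoc]
  have h1 : ‖ξ‖ₑ * ‖(‖ξ‖^2)⁻¹ • ξ‖ₑ = 1 := by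
    have : ‖ξ‖ * ((‖ξ‖^2)⁻¹ * ‖ξ‖) = 1 := by field_simp
    rw [← enorm_norm ξ, ← enorm_norm (_ • ξ), ← enorm_mul, norm_smul, norm_inv, norm_pow, norm_norm,
      this]
    simp
  rw [h1, one_mul]
  have h2 : ∀ x : ℝ, {x | 0 < ⟪ξ, x⟫_ℝ ∧ ⟪ξ, x⟫_ℝ ≤ 1 ∧ (⟪ξ, x⟫_ℝ)⁻¹ • x ∈ Z} ∩
      (AffineSubspace.mk' (x • (‖ξ‖^2)⁻¹ • ξ +ᵥ (0 : EuclideanSpace ℝ (Fin n))) (ℝ ∙ (‖ξ‖^2)⁻¹ • ξ)ᗮ : Set _)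
      = {y | x ∈ Set.Ioc (0:ℝ) 1 ∧ ⟪ξ, y⟫_ℝ = x ∧ x⁻¹ • y ∈ Z} := by
    intro x
    ext y
    have : y ∈ (AffineSubspace.mk' (x • (‖ξ‖^2)⁻¹ • ξ +ᵥ (0 : EuclideanSpace ℝ (Fin n))) (ℝ ∙ (‖ξ‖^2)⁻¹ • ξ)ᗮ : Set _) ↔ ⟪ξ, y⟫_ℝ = x := by
      simp only [SetLike.mem_coe, AffineSubspace.mem_mk', Submodule.mem_orthogonal_singleton_iff_inner_right, vsub_eq_sub, vadd_eq_add, add_zero, inner_sub_right, inner_smul_left, inner_smul_right, real_inner_self_eq_norm_sq]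
      simp
      field_simp
      rw [mul_zero, sub_eq_zero]
    rw [Set.mem_inter_iff, this]
    simp only [Set.mem_ofPred_eq, Set.mem_Ioc]
    constructor
    · rintro ⟨h, rfl⟩; tauto
    · rintro ⟨h, rfl, h'⟩; tauto
  have h3 : ∀ x : ℝ, (μHE[n-1] : Measure (EuclideanSpace ℝ (Fin n))) {y | x ∈ Set.Ioc (0:ℝ) 1 ∧ ⟪ξ, y⟫_ℝ = x ∧ x⁻¹ • y ∈ Z}
      = (Set.Ioc (0:ℝ) 1).indicator (fun x => ENNReal.ofReal (x ^ (n-1)) * μHE[n-1] Z) x := by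
    intro x
    by_cases hx : x ∈ Set.Ioc (0:ℝ) 1
    · rw [Set.indicator_of_mem hx]
      have hx0 : x ≠ 0 := hx.1.ne'
      have : {y | x ∈ Set.Ioc (0:ℝ) 1 ∧ ⟪ξ, y⟫_ℝ = x ∧ x⁻¹ • y ∈ Z} = (fun y => x • y) '' Z := by
        ext y
        simp only [hx, true_and, Set.mem_ofPred_eq, Set.mem_image]
        constructor
        · rintro ⟨h, h'⟩; exact ⟨_, h', by rw [smul_smul, mul_inv_cancel₀ hx0, one_smul]⟩
        · rintro ⟨z, hz, rfl⟩
          rw [inner_smul_right, hZ1 z hz, smul_smul, inv_mul_cancel₀ hx0, one_smul]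
          simp [hz]
      rw [this, Set.image_smul, Measure.euclideanHausdorffMeasure_def]
      simp only [Measure.smul_apply]
      rw [Measure.hausdorffMeasure_smul₀ (by positivity) hx0, NNReal.rpow_natCast]
      rw [smul_comm]
      rw [ENNReal.smul_def, smul_eq_mul]
      congr 1
      rw [ENNReal.ofReal_pow hx.1.le, ENNReal.coe_pow]
      congr 1
      rw [← Real.enorm_of_nonneg hx.1.le]; rfl
    · rw [Set.indicator_of_notMem hx]
      simp [hx]
  simp_rw [h2, h3]
  rw [lintegral_indicator measurableSet_Ioc, lintegral_mul_const _ (by fun_prop)]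
  rw [Measure.euclideanHausdorffMeasure_def, coneC]
  have : (n:ℝ) - 1 = ((n-1:ℕ):ℝ) := by push_cast [hn]; ring
  rw [this]
  simp only [Measure.smul_apply, ENNReal.smul_def, smul_eq_mul]
  ring

structure IsG {n : ℕ} (g : EuclideanSpace ℝ (Fin n) → ℝ) : Prop where
  lip : ∃ Λ, LipschitzWith Λ g
  pos : ∀ x, x ≠ 0 → 0 < g x
  hom : ∀ (a : ℝ) x, 0 ≤ a → g (a • x) = a * g x
  conv : ConvexOn ℝ Set.univ g

noncomputable def prj {n : ℕ} (g : EuclideanSpace ℝ (Fin n) → ℝ) (x : EuclideanSpace ℝ (Fin n)) :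
    EuclideanSpace ℝ (Fin n) := (g x)⁻¹ • x

lemma IsG.zero {n : ℕ} {g : EuclideanSpace ℝ (Fin n) → ℝ} (hg : IsG g) : g 0 = 0 := by
  simpa using hg.hom 0 0 le_rfl

lemma IsG.cont {n : ℕ} {g : EuclideanSpace ℝ (Fin n) → ℝ} (hg : IsG g) : Continuous g :=
  hg.lip.choose_spec.continuous

lemma IsG.prj_smul {n : ℕ} {g : EuclideanSpace ℝ (Fin n) → ℝ} (hg : IsG g) {a : ℝ} (ha : 0 < a)
    (x : EuclideanSpace ℝ (Fin n)) : prj g (a • x) = prj g x := by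
  unfold prj
  rw [hg.hom a x ha.le, smul_smul]
  congr 1
  rw [mul_inv]; field_simp

lemma IsG.g_prj {n : ℕ} {g : EuclideanSpace ℝ (Fin n) → ℝ} (hg : IsG g)
    {x : EuclideanSpace ℝ (Fin n)} (hx : x ≠ 0) : g (prj g x) = 1 := by
  unfold prj
  rw [hg.hom _ x (inv_nonneg.2 (hg.pos x hx).le), inv_mul_cancel₀ (hg.pos x hx).ne']

lemma IsG.measurable_prj {n : ℕ} {g : EuclideanSpace ℝ (Fin n) → ℝ} (hg : IsG g) :
    Measurable (prj g) := by
  have := hg.cont.measurable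
  unfold prj
  fun_prop

lemma lipA {n : ℕ} (φ : EuclideanSpace ℝ (Fin n) → ℝ) (s : Set (EuclideanSpace ℝ (Fin n)))
    (L : NNReal) (R : NNReal) (hφ : LipschitzOnWith L φ s) (h1 : ∀ y ∈ s, |φ y| ≤ 1/2)
    (h2 : ∀ y ∈ s, |φ y| ≤ L) (hR : ∀ y ∈ s, ‖y‖ ≤ R) :
    LipschitzOnWith (1 + L * (2 + 4 * R)) (fun y => (1 + φ y)⁻¹ • y) s := by
  refine LipschitzOnWith.of_dist_le_mul fun y hy y' hy' => ?_
  have e1 : |φ y - φ y'| ≤ L * ‖y - y'‖ := by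
    have := hφ.dist_le_mul y hy y' hy'
    rwa [Real.dist_eq, dist_eq_norm] at this
  have p1 : (1/2:ℝ) ≤ 1 + φ y := by linarith [(abs_le.1 (h1 y hy)).1]
  have p2 : (1/2:ℝ) ≤ 1 + φ y' := by linarith [(abs_le.1 (h1 y' hy')).1]
  have i1 : (1 + φ y)⁻¹ ≤ 2 := by
    rw [inv_le_comm₀ (by linarith) (by norm_num)]; linarith
  have i2 : (1 + φ y')⁻¹ ≤ 2 := by
    rw [inv_le_comm₀ (by linarith) (by norm_num)]; linarith
  have j1 : 0 ≤ (1 + φ y)⁻¹ := inv_nonneg.2 (by linarith)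
  have j2 : 0 ≤ (1 + φ y')⁻¹ := inv_nonneg.2 (by linarith)
  have a1 : |(1 + φ y)⁻¹ - 1| ≤ 2 * L := by
    have : (1 + φ y)⁻¹ - 1 = -((1 + φ y)⁻¹ * φ y) := by
      have : 1 + φ y ≠ 0 := by linarith
      field_simp; ring
    rw [this, abs_neg, abs_mul, abs_of_nonneg j1]
    exact mul_le_mul i1 (h2 y hy) (abs_nonneg _) (by norm_num)
  have a2 : |(1 + φ y)⁻¹ - (1 + φ y')⁻¹| ≤ 4 * (L * ‖y - y'‖) := by
    have : (1 + φ y)⁻¹ - (1 + φ y')⁻¹ = -((1 + φ y)⁻¹ * (1 + φ y')⁻¹ * (φ y - φ y')) := by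
      have : 1 + φ y ≠ 0 := by linarith
      have : 1 + φ y' ≠ 0 := by linarith
      field_simp; ring
    rw [this, abs_neg, abs_mul, abs_of_nonneg (mul_nonneg j1 j2)]
    refine mul_le_mul ?_ e1 (abs_nonneg _) (by norm_num)
    nlinarith
  rw [dist_eq_norm, dist_eq_norm]
  have : (1 + φ y)⁻¹ • y - (1 + φ y')⁻¹ • y' = (y - y') + ((1 + φ y)⁻¹ - 1) • (y - y')
      + ((1 + φ y)⁻¹ - (1 + φ y')⁻¹) • y' := by
    module
  rw [this]
  calc _ ≤ ‖y - y'‖ + ‖((1 + φ y)⁻¹ - 1) • (y - y')‖ + ‖((1 + φ y)⁻¹ - (1 + φ y')⁻¹) • y'‖ :=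
        norm_add₃_le
    _ ≤ ‖y - y'‖ + (2 * L) * ‖y - y'‖ + (4 * (L * ‖y - y'‖)) * R := by
        rw [norm_smul, norm_smul, Real.norm_eq_abs, Real.norm_eq_abs]
        have := hR y' hy'
        gcongr
    _ = _ := by push_cast; ring

lemma core {n : ℕ} {g : EuclideanSpace ℝ (Fin n) → ℝ} (hg : IsG g)
    (y0 ξ : EuclideanSpace ℝ (Fin n)) (hy0 : g y0 = 1) (hξ : ⟪ξ, y0⟫_ℝ = 1) (L : NNReal)
    {r : ℝ} (hr : 0 < r) (hL : LipschitzOnWith L (fun y => g y - ⟪ξ, y⟫_ℝ) (ball y0 r))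
    {d : ℝ} (hd : 0 ≤ d) :
    ∃ U ∈ 𝓝 y0, ∀ A ⊆ U, (∀ y ∈ A, g y = 1) →
      μH[d] {z | ⟪ξ, z⟫_ℝ = 1 ∧ prj g z ∈ A} ≤
        ((1 + L * (2 + 4 * (‖y0‖₊ + 1)) : NNReal) : ℝ≥0∞) ^ d * μH[d] A ∧
      μH[d] A ≤ ((1 + L * (2 + 4 * (‖y0‖₊ + 1)) : NNReal) : ℝ≥0∞) ^ d *
        μH[d] {z | ⟪ξ, z⟫_ℝ = 1 ∧ prj g z ∈ A} := by
  set Q : NNReal := 1 + L * (2 + 4 * (‖y0‖₊ + 1)) with hQ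
  have hQ1 : (1:ℝ) ≤ Q := by
    have : (1:NNReal) ≤ Q := by simp [hQ]
    exact_mod_cast this
  set r1 : ℝ := min r (1 / (2 * ((L:ℝ) + 1))) with hr1
  have hr1pos : 0 < r1 := by positivity
  have hr1r : r1 ≤ r := min_le_left _ _
  have hr1L : r1 * (L + 1) ≤ 1/2 := by
    have : r1 ≤ 1 / (2 * ((L:ℝ) + 1)) := min_le_right _ _
    calc r1 * (L + 1) ≤ 1 / (2 * ((L:ℝ) + 1)) * (L + 1) := by gcongr
      _ = 1/2 := by field_simp
  have hL0 : (0:ℝ) ≤ L := L.2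
  have hr1one : r1 ≤ 1/2 := by nlinarith
  set f : EuclideanSpace ℝ (Fin n) → ℝ := fun y => g y - ⟪ξ, y⟫_ℝ with hf
  have hf0 : f y0 = 0 := by simp [hf, hy0, hξ]
  have hLf : LipschitzOnWith L f (ball y0 r1) := hL.mono (ball_subset_ball hr1r)
  have hy0b : y0 ∈ ball y0 r1 := mem_ball_self hr1pos
  have hfb : ∀ y ∈ ball y0 r1, |f y| ≤ L * r1 := by
    intro y hy
    have := hLf.dist_le_mul y hy y0 hy0b
    rw [hf0, Real.dist_eq, sub_zero] at this
    refine this.trans ?_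
    have := (mem_ball.1 hy).le
    gcongr
  have hfb1 : ∀ y ∈ ball y0 r1, |f y| ≤ 1/2 := fun y hy => (hfb y hy).trans (by nlinarith)
  have hfb2 : ∀ y ∈ ball y0 r1, |f y| ≤ L := fun y hy => (hfb y hy).trans (by nlinarith)
  have hnb : ∀ y ∈ ball y0 r1, ‖y‖ ≤ ((‖y0‖₊ + 1 : NNReal) : ℝ) := by
    intro y hy
    have h1 := mem_ball.1 hy
    rw [dist_eq_norm] at h1
    have : ‖y‖ ≤ ‖y - y0‖ + ‖y0‖ := by simpa using norm_add_le (y - y0) y0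
    push_cast; linarith
  have lipS : LipschitzOnWith Q (fun y => (1 + f y)⁻¹ • y) (ball y0 r1) :=
    lipA f _ L _ hLf hfb1 hfb2 hnb
  have lipP : LipschitzOnWith Q (fun y => (1 + (-f) y)⁻¹ • y) (ball y0 r1) := by
    refine lipA (-f) _ L _ ?_ ?_ ?_ hnb
    · refine LipschitzOnWith.of_dist_le_mul fun y hy y' hy' => ?_
      have := hLf.dist_le_mul y hy y' hy'
      simpa [dist_neg_neg] using this
    · simpa using hfb1
    · simpa using hfb2
  have hr1Q : r1 / Q ≤ r1 := div_le_self hr1pos.le hQ1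
  refine ⟨ball y0 (r1 / Q), ball_mem_nhds _ (by positivity), fun A hAU hA1 => ?_⟩
  have hAb : A ⊆ ball y0 r1 := hAU.trans (ball_subset_ball hr1Q)
  have hpA : ∀ y ∈ A, (1 + (-f) y) = ⟪ξ, y⟫_ℝ := by
    intro y hy; simp [hf, hA1 y hy]
  have hne : ∀ z, ⟪ξ, z⟫_ℝ = 1 → 0 < g z := by
    intro z hz
    refine hg.pos z ?_
    rintro rfl; simp at hz
  have hZ : ∀ z, ⟪ξ, z⟫_ℝ = 1 → prj g z ∈ A → (1 + (-f) (prj g z))⁻¹ • (prj g z) = z := by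
    intro z h1 h2
    rw [hpA _ h2]
    have := (hne z h1).ne'
    rw [prj, inner_smul_right, h1, smul_smul]
    simp [this]
  constructor
  · have sub : {z | ⟪ξ, z⟫_ℝ = 1 ∧ prj g z ∈ A} ⊆ (fun y => (1 + (-f) y)⁻¹ • y) '' A := by
      rintro z ⟨h1, h2⟩
      exact ⟨_, h2, hZ z h1 h2⟩
    exact (measure_mono sub).trans ((lipP.mono hAb).hausdorffMeasure_image_le hd)
  · have sub : A ⊆ (fun y => (1 + f y)⁻¹ • y) '' {z | ⟪ξ, z⟫_ℝ = 1 ∧ prj g z ∈ A} := by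
      intro y hy
      have hpos : 0 < ⟪ξ, y⟫_ℝ := by
        rw [← hpA y hy]
        have := (abs_le.1 (hfb1 y (hAb hy))).2
        simp only [Pi.neg_apply]; linarith
      have h1 : ⟪ξ, (⟪ξ, y⟫_ℝ)⁻¹ • y⟫_ℝ = 1 := by
        rw [inner_smul_right, inv_mul_cancel₀ hpos.ne']
      have h2 : prj g ((⟪ξ, y⟫_ℝ)⁻¹ • y) = y := by
        rw [hg.prj_smul (inv_pos.2 hpos), prj, hA1 y hy]; simp
      refine ⟨(⟪ξ, y⟫_ℝ)⁻¹ • y, ⟨h1, by rwa [h2]⟩, ?_⟩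
      have : 1 + f ((⟪ξ, y⟫_ℝ)⁻¹ • y) = g ((⟪ξ, y⟫_ℝ)⁻¹ • y) := by
        simp only [hf]; rw [h1]; ring
      simp only [this]
      exact h2
    have zb : {z | ⟪ξ, z⟫_ℝ = 1 ∧ prj g z ∈ A} ⊆ ball y0 r1 := by
      rintro z ⟨h1, h2⟩
      have e0 : (1 + (-f) y0)⁻¹ • y0 = y0 := by simp [hf0]
      have := lipP.dist_le_mul _ (hAb h2) _ hy0b
      rw [hZ z h1 h2, e0] at this
      rw [mem_ball]
      refine this.trans_lt ?_
      have h3 := mem_ball.1 (hAU h2)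
      rw [lt_div_iff₀ (by linarith)] at h3
      linarith
    exact (measure_mono sub).trans ((lipS.mono zb).hausdorffMeasure_image_le hd)

noncomputable def Vm {n : ℕ} (g : EuclideanSpace ℝ (Fin n) → ℝ) :
    Measure (EuclideanSpace ℝ (Fin n)) :=
  (volume.restrict (closedBall 0 1)).map (prj g)

lemma IsG.Vm_apply {n : ℕ} {g : EuclideanSpace ℝ (Fin n) → ℝ} (hg : IsG g)
    {A : Set (EuclideanSpace ℝ (Fin n))} (hA : MeasurableSet A) :
    Vm g A = volume {x | prj g x ∈ A ∧ ‖x‖ ≤ 1} := by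
  rw [Vm, Measure.map_apply hg.measurable_prj hA, Measure.restrict_apply (hg.measurable_prj hA)]
  congr 1
  ext x
  simp

open scoped Pointwise in
lemma volcmp {n : ℕ} {g : EuclideanSpace ℝ (Fin n) → ℝ} (hg : IsG g)
    (ξ : EuclideanSpace ℝ (Fin n)) {A : Set (EuclideanSpace ℝ (Fin n))} (hA : MeasurableSet A)
    {t1 t2 : ℝ} (ht1 : 0 < t1) (ht2 : 0 < t2) (hA1 : ∀ y ∈ A, g y = 1)
    (h1 : ∀ y ∈ A, t1 * ‖y‖ ≤ ⟪ξ, y⟫_ℝ) (h2 : ∀ y ∈ A, ⟪ξ, y⟫_ℝ ≤ t2 * ‖y‖) :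
    volume {x | 0 < ⟪ξ, x⟫_ℝ ∧ ⟪ξ, x⟫_ℝ ≤ 1 ∧
      (⟪ξ, x⟫_ℝ)⁻¹ • x ∈ {z | ⟪ξ, z⟫_ℝ = 1 ∧ prj g z ∈ A}} ≤ ENNReal.ofReal (t1⁻¹ ^ n) * Vm g A ∧
    Vm g A ≤ ENNReal.ofReal (t2 ^ n) * volume {x | 0 < ⟪ξ, x⟫_ℝ ∧ ⟪ξ, x⟫_ℝ ≤ 1 ∧
      (⟪ξ, x⟫_ℝ)⁻¹ • x ∈ {z | ⟪ξ, z⟫_ℝ = 1 ∧ prj g z ∈ A}} := by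
  rw [hg.Vm_apply hA]
  have key : ∀ x, prj g x ∈ A → x ≠ 0 ∧ t1 * ‖x‖ ≤ ⟪ξ, x⟫_ℝ ∧ ⟪ξ, x⟫_ℝ ≤ t2 * ‖x‖ := by
    intro x hx
    have hx0 : x ≠ 0 := by
      rintro rfl
      have := hA1 _ hx
      simp [prj, hg.zero] at this
    have hgx := hg.pos x hx0
    have hn : ‖prj g x‖ = (g x)⁻¹ * ‖x‖ := by
      rw [prj, norm_smul, Real.norm_of_nonneg (inv_nonneg.2 hgx.le)]
    have hi : ⟪ξ, prj g x⟫_ℝ = (g x)⁻¹ * ⟪ξ, x⟫_ℝ := by rw [prj, inner_smul_right]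
    have a1 := h1 _ hx
    have a2 := h2 _ hx
    rw [hn, hi, mul_left_comm] at a1
    rw [hn, hi, mul_left_comm] at a2
    have := inv_pos.2 hgx
    exact ⟨hx0, le_of_mul_le_mul_left a1 this, le_of_mul_le_mul_left a2 this⟩
  have hfr : Module.finrank ℝ (EuclideanSpace ℝ (Fin n)) = n := finrank_euclideanSpace_fin
  have hsm : ∀ (t : ℝ), 0 < t → ∀ S : Set (EuclideanSpace ℝ (Fin n)),
      volume (t • S) = ENNReal.ofReal (t ^ n) * volume S := by
    intro t ht S
    rw [Measure.addHaar_smul_of_nonneg _ ht.le, hfr]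
  constructor
  · rw [← hsm _ (inv_pos.2 ht1)]
    refine measure_mono ?_
    rintro x ⟨hx1, hx2, -, hx3⟩
    rw [hg.prj_smul (inv_pos.2 hx1)] at hx3
    obtain ⟨hx0, a1, a2⟩ := key x hx3
    rw [Set.mem_inv_smul_set_iff₀ ht1.ne']
    refine ⟨by rwa [hg.prj_smul ht1], ?_⟩
    rw [norm_smul, Real.norm_of_nonneg ht1.le]; linarith
  · rw [← hsm _ ht2]
    refine measure_mono ?_
    rintro x ⟨hx3, hx1⟩
    obtain ⟨hx0, a1, a2⟩ := key x hx3
    have hxp : 0 < ‖x‖ := norm_pos_iff.2 hx0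
    rw [Set.mem_smul_set_iff_inv_smul_mem₀ ht2.ne']
    have hpos : 0 < ⟪ξ, x⟫_ℝ := lt_of_lt_of_le (by positivity) a1
    have hi : ⟪ξ, t2⁻¹ • x⟫_ℝ = t2⁻¹ * ⟪ξ, x⟫_ℝ := inner_smul_right _ _ _
    have hip : 0 < ⟪ξ, t2⁻¹ • x⟫_ℝ := by rw [hi]; positivity
    refine ⟨hip, ?_, ?_, ?_⟩
    · rw [hi, inv_mul_le_iff₀ ht2]; nlinarith
    · rw [inner_smul_right, inv_mul_cancel₀ hip.ne']
    · rw [hg.prj_smul (inv_pos.2 hip), hg.prj_smul (inv_pos.2 ht2)]; exact hx3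

noncomputable def kap (n : ℕ) (R : NNReal) (s : NNReal) : ℝ≥0∞ :=
  ((1 + s * (2 + 4 * (R + 1)) : NNReal) : ℝ≥0∞) ^ ((n:ℝ) - 1) * ENNReal.ofReal ((1 + (s:ℝ)) ^ n)

lemma kap_ne_top {n : ℕ} (hn : 1 ≤ n) (R s : NNReal) : kap n R s ≠ ∞ := by
  have : (1:ℝ) ≤ n := by exact_mod_cast hn
  exact ENNReal.mul_ne_top (ENNReal.rpow_ne_top_of_nonneg (by linarith) ENNReal.coe_ne_top)
    ENNReal.ofReal_ne_top

lemma kap_tendsto (n : ℕ) (R : NNReal) : Tendsto (kap n R) (𝓝 0) (𝓝 1) := by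
  have h1 : Tendsto (fun s : NNReal => ((1 + s * (2 + 4 * (R + 1)) : NNReal) : ℝ≥0∞) ^ ((n:ℝ) - 1))
      (𝓝 0) (𝓝 1) := by
    have : Tendsto (fun s : NNReal => ((1 + s * (2 + 4 * (R + 1)) : NNReal) : ℝ≥0∞)) (𝓝 0) (𝓝 1) := by
      have : Continuous (fun s : NNReal => ((1 + s * (2 + 4 * (R + 1)) : NNReal) : ℝ≥0∞)) := by
        fun_prop
      simpa using this.tendsto 0
    have h := ((ENNReal.continuous_rpow_const (y := (n:ℝ) - 1)).tendsto 1).comp this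
    rw [ENNReal.one_rpow] at h
    exact h
  have h2 : Tendsto (fun s : NNReal => ENNReal.ofReal ((1 + (s:ℝ)) ^ n)) (𝓝 0) (𝓝 1) := by
    have : Continuous (fun s : NNReal => ENNReal.ofReal ((1 + (s:ℝ)) ^ n)) :=
      ENNReal.continuous_ofReal.comp (by fun_prop)
    simpa using this.tendsto 0
  have := ENNReal.Tendsto.mul h1 (by simp) h2 (by simp)
  rw [one_mul] at this
  exact this

lemma loc {n : ℕ} (hn : 1 ≤ n) {g : EuclideanSpace ℝ (Fin n) → ℝ} (hg : IsG g)
    (y0 ξ : EuclideanSpace ℝ (Fin n)) (hy0 : g y0 = 1) (hξ : ⟪ξ, y0⟫_ℝ = 1) (s : NNReal)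
    (hs : 0 < s)
    {r : ℝ} (hr : 0 < r) (hL : LipschitzOnWith s (fun y => g y - ⟪ξ, y⟫_ℝ) (ball y0 r)) :
    ∃ U ∈ 𝓝 y0, ∀ A ⊆ U, MeasurableSet A → (∀ y ∈ A, g y = 1) →
      ‖ξ‖ₑ * ‖y0‖ₑ ^ n * Vm g A ≤ kap n ‖y0‖₊ s * (coneC n * μH[(n:ℝ) - 1] A) ∧
      coneC n * μH[(n:ℝ) - 1] A ≤ kap n ‖y0‖₊ s * (‖ξ‖ₑ * ‖y0‖ₑ ^ n * Vm g A) := by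
  have hn' : (1:ℝ) ≤ n := by exact_mod_cast hn
  obtain ⟨U, hU, hUA⟩ := core hg y0 ξ hy0 hξ s hr hL (d := (n:ℝ) - 1) (by linarith)
  have hy00 : y0 ≠ 0 := by rintro rfl; simp at hξ
  have hξ0 : ξ ≠ 0 := by rintro rfl; simp at hξ
  have hyp : 0 < ‖y0‖ := norm_pos_iff.2 hy00
  have hs' : (0:ℝ) < s := hs
  set t2 : ℝ := (1 + (s:ℝ)) * ‖y0‖⁻¹ with ht2
  set t1 : ℝ := (1 + (s:ℝ))⁻¹ * ‖y0‖⁻¹ with ht1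
  have t1p : 0 < t1 := by positivity
  have t2p : 0 < t2 := by positivity
  have e1 : ∀ᶠ y in 𝓝 y0, t1 * ‖y‖ < ⟪ξ, y⟫_ℝ := by
    have c : ContinuousAt (fun y => ⟪ξ, y⟫_ℝ - t1 * ‖y‖) y0 := by fun_prop
    have : 0 < ⟪ξ, y0⟫_ℝ - t1 * ‖y0‖ := by
      rw [hξ, ht1, mul_assoc, inv_mul_cancel₀ hyp.ne', mul_one, sub_pos]
      exact inv_lt_one_of_one_lt₀ (by linarith)
    filter_upwards [c.eventually_const_lt this] with y hy
    linarith
  have e2 : ∀ᶠ y in 𝓝 y0, ⟪ξ, y⟫_ℝ < t2 * ‖y‖ := by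
    have c : ContinuousAt (fun y => t2 * ‖y‖ - ⟪ξ, y⟫_ℝ) y0 := by fun_prop
    have : 0 < t2 * ‖y0‖ - ⟪ξ, y0⟫_ℝ := by
      rw [hξ, ht2, mul_assoc, inv_mul_cancel₀ hyp.ne', mul_one, sub_pos]
      linarith
    filter_upwards [c.eventually_const_lt this] with y hy
    linarith
  refine ⟨U ∩ {y | t1 * ‖y‖ < ⟪ξ, y⟫_ℝ ∧ ⟪ξ, y⟫_ℝ < t2 * ‖y‖}, inter_mem hU (e1.and e2),
    fun A hAU hA hA1 => ?_⟩
  obtain ⟨b1, b2⟩ := hUA A (fun y hy => (hAU hy).1) hA1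
  obtain ⟨c1, c2⟩ := volcmp hg ξ hA t1p t2p hA1 (fun y hy => (hAU hy).2.1.le)
    (fun y hy => (hAU hy).2.2.le)
  have hZm : MeasurableSet {z | ⟪ξ, z⟫_ℝ = 1 ∧ prj g z ∈ A} :=
    (measurableSet_eq_fun (by fun_prop) measurable_const).inter (hg.measurable_prj hA)
  have cv := cone_vol hn ξ hξ0 _ hZm (fun z hz => hz.1)
  set Z := {z | ⟪ξ, z⟫_ℝ = 1 ∧ prj g z ∈ A}
  set T := volume {x | 0 < ⟪ξ, x⟫_ℝ ∧ ⟪ξ, x⟫_ℝ ≤ 1 ∧ (⟪ξ, x⟫_ℝ)⁻¹ • x ∈ Z}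
  set M : ℝ≥0∞ := ((1 + s * (2 + 4 * (‖y0‖₊ + 1)) : NNReal) : ℝ≥0∞) ^ ((n:ℝ) - 1) with hM
  have f2 : ‖y0‖ₑ ^ n * ENNReal.ofReal (t2 ^ n) = ENNReal.ofReal ((1 + (s:ℝ)) ^ n) := by
    rw [← ofReal_norm, ← ENNReal.ofReal_pow hyp.le, ← ENNReal.ofReal_mul (by positivity),
      ← mul_pow]
    congr 2; rw [ht2]; field_simp
  have f1 : ENNReal.ofReal (t1⁻¹ ^ n) = ENNReal.ofReal ((1 + (s:ℝ)) ^ n) * ‖y0‖ₑ ^ n := by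
    rw [← ofReal_norm, ← ENNReal.ofReal_pow hyp.le, ← ENNReal.ofReal_mul (by positivity),
      ← mul_pow]
    congr 2; rw [ht1]; field_simp
  constructor
  · calc ‖ξ‖ₑ * ‖y0‖ₑ ^ n * Vm g A ≤ ‖ξ‖ₑ * ‖y0‖ₑ ^ n * (ENNReal.ofReal (t2 ^ n) * T) := by gcongr
      _ = (‖y0‖ₑ ^ n * ENNReal.ofReal (t2 ^ n)) * (‖ξ‖ₑ * T) := by ring
      _ = ENNReal.ofReal ((1 + (s:ℝ)) ^ n) * (coneC n * μH[(n:ℝ) - 1] Z) := by rw [f2, cv]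
      _ ≤ ENNReal.ofReal ((1 + (s:ℝ)) ^ n) * (coneC n * (M * μH[(n:ℝ) - 1] A)) := by gcongr
      _ = _ := by rw [kap, ← hM]; ring
  · calc coneC n * μH[(n:ℝ) - 1] A ≤ coneC n * (M * μH[(n:ℝ) - 1] Z) := by gcongr
      _ = M * (coneC n * μH[(n:ℝ) - 1] Z) := by ring
      _ = M * (‖ξ‖ₑ * T) := by rw [cv]
      _ ≤ M * (‖ξ‖ₑ * (ENNReal.ofReal (t1⁻¹ ^ n) * Vm g A)) := by gcongr
      _ = _ := by rw [f1, kap, ← hM]; ring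

lemma IsG.euler {n : ℕ} {g : EuclideanSpace ℝ (Fin n) → ℝ} (hg : IsG g)
    {y0 : EuclideanSpace ℝ (Fin n)} (hd : DifferentiableAt ℝ g y0) :
    fderiv ℝ g y0 y0 = g y0 := by
  have h1 : HasDerivAt (fun t : ℝ => t • y0) y0 1 := by
    simpa using (hasDerivAt_id (1:ℝ)).smul_const y0
  have h2 : HasDerivAt (fun t : ℝ => g (t • y0)) (fderiv ℝ g y0 y0) 1 := by
    have h3 : HasFDerivAt g (fderiv ℝ g y0) ((1:ℝ) • y0) := by
      rw [one_smul]; exact hd.hasFDerivAt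
    exact h3.comp_hasDerivAt (1:ℝ) h1
  have h4 : HasDerivAt (fun t : ℝ => t * g y0) (g y0) 1 := by
    simpa using (hasDerivAt_id (1:ℝ)).mul_const (g y0)
  have h5 : (fun t : ℝ => g (t • y0)) =ᶠ[𝓝 1] (fun t : ℝ => t * g y0) := by
    filter_upwards [lt_mem_nhds (zero_lt_one (α := ℝ))] with t ht
    exact hg.hom t y0 ht.le
  exact (h2.congr_of_eventuallyEq h5.symm).unique h4

lemma IsG.lipNear {n : ℕ} {g : EuclideanSpace ℝ (Fin n) → ℝ} (hg : IsG g)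
    {y0 : EuclideanSpace ℝ (Fin n)} (hd : DifferentiableAt ℝ g y0)
    {s : NNReal} (hs : 0 < s) :
    ∃ r > 0, LipschitzOnWith s (fun y => g y - fderiv ℝ g y0 y) (ball y0 r) := by
  have hs' : (0:ℝ) < s := hs
  have ho := hd.hasFDerivAt.isLittleO.def (c := s/4) (by positivity)
  obtain ⟨r, hr, hb⟩ := Metric.eventually_nhds_iff_ball.1 ho
  have he := hg.euler hd
  have hM : ∀ a, dist a y0 < r → |g a - fderiv ℝ g y0 a| ≤ s/4 * r := by
    intro a ha
    have h := hb a ha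
    have : g a - g y0 - fderiv ℝ g y0 (a - y0) = g a - fderiv ℝ g y0 a := by
      rw [map_sub, he]; ring
    rw [this, Real.norm_eq_abs] at h
    refine h.trans ?_
    rw [← dist_eq_norm]
    gcongr
  have hc : ConvexOn ℝ (ball y0 r) (fun y => g y - fderiv ℝ g y0 y) := by
    have h1 : ConvexOn ℝ (ball y0 r) g := hg.conv.subset (Set.subset_univ _) (convex_ball _ _)
    have h2 : ConcaveOn ℝ (ball y0 r) (fun y => fderiv ℝ g y0 y) :=
      (fderiv ℝ g y0).toLinearMap.concaveOn (convex_ball _ _)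
    exact h1.sub h2
  have := hc.lipschitzOnWith_of_abs_le (ε := r/2) (by positivity) hM
  refine ⟨r/2, by positivity, ?_⟩
  have e1 : r - r/2 = r/2 := by ring
  have e2 : (2 * (s/4*r) / (r/2)).toNNReal = s := by
    have : 2 * ((s:ℝ)/4*r) / (r/2) = s := by field_simp; ring
    rw [this, Real.toNNReal_coe]
  rwa [e1, e2] at this

lemma IsG.fderiv_cont {n : ℕ} {g : EuclideanSpace ℝ (Fin n) → ℝ} (hg : IsG g)
    {y0 : EuclideanSpace ℝ (Fin n)} (hd : DifferentiableAt ℝ g y0) :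
    Tendsto (fderiv ℝ g) (𝓝[{y | DifferentiableAt ℝ g y}] y0) (𝓝 (fderiv ℝ g y0)) := by
  rw [Metric.tendsto_nhds]
  intro ε hε
  obtain ⟨r, hr, hL⟩ := hg.lipNear hd (s := (ε/2).toNNReal) (by simpa using hε)
  have : ball y0 r ∈ 𝓝[{y | DifferentiableAt ℝ g y}] y0 :=
    mem_nhdsWithin_of_mem_nhds (ball_mem_nhds _ hr)
  filter_upwards [this, self_mem_nhdsWithin] with y hy hyd
  have h1 := norm_fderiv_le_of_lipschitzOn ℝ (isOpen_ball.mem_nhds hy) hL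
  have h2 : HasFDerivAt (fun y => g y - fderiv ℝ g y0 y) (fderiv ℝ g y - fderiv ℝ g y0) y :=
    (DifferentiableAt.hasFDerivAt hyd).sub (fderiv ℝ g y0).hasFDerivAt
  rw [h2.fderiv, Real.coe_toNNReal _ (by positivity)] at h1
  rw [dist_eq_norm]; linarith

lemma loc2glob {α : Type*} [TopologicalSpace α] [SecondCountableTopology α] [MeasurableSpace α]
    [OpensMeasurableSpace α]
    (μ1 μ2 : Measure α) (c : ℝ≥0∞) {s : Set α} (hs : MeasurableSet s) (h0 : μ1 sᶜ = 0)
    (h : ∀ x ∈ s, ∃ U ∈ 𝓝 x, ∀ A ⊆ U ∩ s, MeasurableSet A → μ1 A ≤ c * μ2 A)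
    {A : Set α} (hA : MeasurableSet A) : μ1 A ≤ c * μ2 A := by
  have h' : ∀ x, x ∈ s → ∃ U : Set α, IsOpen U ∧ x ∈ U ∧ ∀ A ⊆ U ∩ s, MeasurableSet A → μ1 A ≤ c * μ2 A := by
    intro x hx
    obtain ⟨U, hU, hUA⟩ := h x hx
    obtain ⟨V, hVU, hV, hxV⟩ := mem_nhds_iff.1 hU
    exact ⟨V, hV, hxV, fun A hA => hUA A (hA.trans (Set.inter_subset_inter_left _ hVU))⟩
  choose! U hUo hxU hUA using h'
  obtain ⟨t, hts, htc, hcov⟩ := TopologicalSpace.countable_cover_nhdsWithin (f := U) (s := s)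
    (fun x hx => mem_nhdsWithin_of_mem_nhds ((hUo x hx).mem_nhds (hxU x hx)))
  have hAs : μ1 A = μ1 (A ∩ s) := by
    rw [measure_inter_conull h0]
  have hfin : c * μ2 (A ∩ s) ≤ c * μ2 A := by
    gcongr
    exact Set.inter_subset_left
  refine hAs.le.trans (le_trans ?_ hfin)
  rcases t.eq_empty_or_nonempty with rfl | hne
  · have : s = ∅ := by simpa using hcov
    simp [this]
  obtain ⟨f, rfl⟩ := htc.exists_eq_range hne
  have hft : ∀ i, f i ∈ s := fun i => hts ⟨i, rfl⟩
  have hcov' : s ⊆ ⋃ i, disjointed (fun i => U (f i)) i := by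
    rw [iUnion_disjointed]
    simpa using hcov
  have hm : ∀ i, MeasurableSet (disjointed (fun i => U (f i)) i) :=
    fun i => MeasurableSet.disjointed (fun i => (hUo _ (hft i)).measurableSet) i
  have hdec : A ∩ s = ⋃ i, (A ∩ s) ∩ disjointed (fun i => U (f i)) i := by
    rw [← Set.inter_iUnion]
    exact (Set.inter_eq_left.2 (Set.inter_subset_right.trans hcov')).symm
  have hdj : Pairwise (Function.onFun Disjoint fun i => (A ∩ s) ∩ disjointed (fun i => U (f i)) i) :=
    fun i j hij => ((disjoint_disjointed (fun i => U (f i))) hij).mono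
      Set.inter_subset_right Set.inter_subset_right
  have e : ∀ μ : Measure α, μ (A ∩ s) = ∑' i, μ ((A ∩ s) ∩ disjointed (fun i => U (f i)) i) := by
    intro μ
    conv_lhs => rw [hdec]
    exact measure_iUnion hdj (fun i => (hA.inter hs).inter (hm i))
  rw [e μ1, e μ2, ← ENNReal.tsum_mul_left]
  refine ENNReal.tsum_le_tsum fun i => ?_
  refine hUA _ (hft i) _ ?_ ((hA.inter hs).inter (hm i))
  exact fun x hx => ⟨disjointed_subset (fun i => U (f i)) i hx.2, hx.1.2⟩

def good {n : ℕ} (g : EuclideanSpace ℝ (Fin n) → ℝ) : Set (EuclideanSpace ℝ (Fin n)) :=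
  {y | g y = 1} ∩ {y | DifferentiableAt ℝ g y}

noncomputable def Dn {n : ℕ} (g : EuclideanSpace ℝ (Fin n) → ℝ) (y : EuclideanSpace ℝ (Fin n)) :
    ℝ≥0∞ := ‖fderiv ℝ g y‖ₑ * ‖y‖ₑ ^ n

lemma measurable_Dn {n : ℕ} (g : EuclideanSpace ℝ (Fin n) → ℝ) : Measurable (Dn g) := by
  unfold Dn
  exact (measurable_fderiv ℝ g).enorm.mul (measurable_enorm.pow_const n)

lemma IsG.meas_level {n : ℕ} {g : EuclideanSpace ℝ (Fin n) → ℝ} (hg : IsG g) :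
    MeasurableSet {y | g y = 1} :=
  (isClosed_eq hg.cont continuous_const).measurableSet

lemma IsG.meas_good {n : ℕ} {g : EuclideanSpace ℝ (Fin n) → ℝ} (hg : IsG g) :
    MeasurableSet (good g) :=
  hg.meas_level.inter (measurableSet_of_differentiableAt ℝ g)

lemma IsG.diff_smul {n : ℕ} {g : EuclideanSpace ℝ (Fin n) → ℝ} (hg : IsG g) {a : ℝ} (ha : 0 < a)
    {x : EuclideanSpace ℝ (Fin n)} (hd : DifferentiableAt ℝ g x) : DifferentiableAt ℝ g (a • x) := by
  have e : g = fun y => a * g (a⁻¹ • y) := by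
    funext y
    rw [hg.hom _ _ (inv_nonneg.2 ha.le), ← mul_assoc, mul_inv_cancel₀ ha.ne', one_mul]
  rw [e]
  have h1 : DifferentiableAt ℝ g (a⁻¹ • (a • x)) := by
    rw [smul_smul, inv_mul_cancel₀ ha.ne', one_smul]; exact hd
  have h2 : DifferentiableAt ℝ (fun y : EuclideanSpace ℝ (Fin n) => a⁻¹ • y) (a • x) := by fun_prop
  exact (DifferentiableAt.comp (a • x) h1 h2).const_mul a

lemma IsG.prj_good {n : ℕ} {g : EuclideanSpace ℝ (Fin n) → ℝ} (hg : IsG g)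
    {x : EuclideanSpace ℝ (Fin n)} (hx : x ≠ 0) (hd : DifferentiableAt ℝ g x) :
    prj g x ∈ good g :=
  ⟨hg.g_prj hx, hg.diff_smul (inv_pos.2 (hg.pos x hx)) hd⟩

lemma IsG.Vm_good {n : ℕ} (hn : 1 ≤ n) {g : EuclideanSpace ℝ (Fin n) → ℝ} (hg : IsG g) :
    Vm g (good g)ᶜ = 0 := by
  have : Nonempty (Fin n) := ⟨⟨0, hn⟩⟩
  rw [hg.Vm_apply hg.meas_good.compl]
  obtain ⟨Λ, hΛ⟩ := hg.lip
  have h1 : volume {x | ¬ DifferentiableAt ℝ g x} = 0 := hΛ.ae_differentiableAt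
  refine measure_mono_null (t := {0} ∪ {x | ¬ DifferentiableAt ℝ g x}) ?_
    (measure_union_null (measure_singleton _) h1)
  rintro x ⟨hx, -⟩
  by_contra hc
  simp only [Set.mem_union, Set.mem_singleton_iff, not_or] at hc
  exact hx (hg.prj_good hc.1 (not_not.1 hc.2))

lemma IsG.haus_good {n : ℕ} (hn : 1 ≤ n) {g : EuclideanSpace ℝ (Fin n) → ℝ} (hg : IsG g) :
    μH[(n:ℝ) - 1] ({y | g y = 1} \ good g) = 0 := by
  refine measure_null_of_locally_null _ fun y0 hy0 => ?_
  have hy1 : g y0 = 1 := hy0.1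
  have hy00 : y0 ≠ 0 := by
    rintro rfl
    rw [hg.zero] at hy1
    exact zero_ne_one hy1
  obtain ⟨Λ, hΛ⟩ := hg.lip
  set ξ : EuclideanSpace ℝ (Fin n) := (‖y0‖ ^ 2)⁻¹ • y0 with hξ
  have hξ1 : ⟪ξ, y0⟫_ℝ = 1 := by
    rw [hξ, real_inner_smul_left, real_inner_self_eq_norm_sq]
    exact inv_mul_cancel₀ (by positivity)
  have hL : LipschitzWith (Λ + ‖innerSL ℝ ξ‖₊ + 1) (fun y => g y - ⟪ξ, y⟫_ℝ) :=
    (hΛ.sub (innerSL ℝ ξ).lipschitz).weaken (by simp)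
  obtain ⟨U, hU, hUA⟩ := loc hn hg y0 ξ hy1 hξ1 _ (by positivity) one_pos
    (hL.lipschitzOnWith (s := ball y0 1))
  obtain ⟨V, hVU, hVo, hyV⟩ := _root_.mem_nhds_iff.1 hU
  refine ⟨({y | g y = 1} \ good g) ∩ V, ?_, ?_⟩
  · exact inter_mem self_mem_nhdsWithin (mem_nhdsWithin_of_mem_nhds (hVo.mem_nhds hyV))
  have h2 := (hUA (({y | g y = 1} \ good g) ∩ V) (fun y hy => hVU hy.2)
    ((hg.meas_level.diff hg.meas_good).inter hVo.measurableSet) (fun y hy => hy.1.1)).2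
  have h3 : Vm g (({y | g y = 1} \ good g) ∩ V) = 0 :=
    measure_mono_null (fun y hy => hy.1.2) (hg.Vm_good hn)
  rw [h3, mul_zero, mul_zero, nonpos_iff_eq_zero, mul_eq_zero] at h2
  exact h2.resolve_left (coneC_ne_zero n)

lemma IsG.Dn_good {n : ℕ} {g : EuclideanSpace ℝ (Fin n) → ℝ} (hg : IsG g)
    {y : EuclideanSpace ℝ (Fin n)} (hy : y ∈ good g) : Dn g y ≠ 0 ∧ Dn g y ≠ ∞ := by
  have h := hg.euler hy.2
  rw [show g y = 1 from hy.1] at h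
  have h1 : y ≠ 0 := by rintro rfl; simp at h
  have h2 : fderiv ℝ g y ≠ 0 := by intro h'; simp [h'] at h
  unfold Dn
  constructor
  · have h3 : ‖fderiv ℝ g y‖ₑ ≠ 0 := by
      rw [← ofReal_norm]
      exact (ENNReal.ofReal_pos.2 (norm_pos_iff.2 h2)).ne'
    exact mul_ne_zero h3 (pow_ne_zero _ (enorm_ne_zero.2 h1))
  · exact ENNReal.mul_ne_top enorm_ne_top (ENNReal.pow_ne_top enorm_ne_top)

lemma IsG.Dn_tendsto {n : ℕ} {g : EuclideanSpace ℝ (Fin n) → ℝ} (hg : IsG g)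
    {y0 : EuclideanSpace ℝ (Fin n)} (hy : y0 ∈ good g) :
    Tendsto (Dn g) (𝓝[good g] y0) (𝓝 (Dn g y0)) := by
  have h1 : Tendsto (fderiv ℝ g) (𝓝[good g] y0) (𝓝 (fderiv ℝ g y0)) :=
    (hg.fderiv_cont hy.2).mono_left (nhdsWithin_mono _ (fun y hy => hy.2))
  have h2 : Tendsto (fun y : EuclideanSpace ℝ (Fin n) => ‖y‖ₑ ^ n) (𝓝[good g] y0) (𝓝 (‖y0‖ₑ ^ n)) :=
    (ENNReal.Tendsto.pow (continuous_enorm.tendsto y0)).mono_left nhdsWithin_le_nhds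
  exact ENNReal.Tendsto.mul h1.enorm (Or.inr (ENNReal.pow_ne_top enorm_ne_top)) h2
    (Or.inr enorm_ne_top)

lemma le_of_kap {a b : ℝ≥0∞} (h : ∀ k : NNReal, 1 < k → a ≤ (k * k : ℝ≥0∞) * b) : a ≤ b := by
  have h1 : Tendsto (fun k : NNReal => (k * k : ℝ≥0∞) * b) (𝓝[>] 1) (𝓝 b) := by
    have h2 : Tendsto (fun k : NNReal => (k * k : ℝ≥0∞)) (𝓝 1) (𝓝 1) := by
      have : Continuous (fun k : NNReal => ((k * k : NNReal) : ℝ≥0∞)) := by fun_prop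
      simpa using this.tendsto 1
    have := ENNReal.Tendsto.mul_const (b := b) h2 (Or.inl one_ne_zero)
    rw [one_mul] at this
    exact this.mono_left nhdsWithin_le_nhds
  refine ge_of_tendsto h1 ?_
  filter_upwards [self_mem_nhdsWithin] with k hk
  exact h k hk

lemma IsG.locD {n : ℕ} (hn : 1 ≤ n) {g : EuclideanSpace ℝ (Fin n) → ℝ} (hg : IsG g)
    {y0 : EuclideanSpace ℝ (Fin n)} (hy : y0 ∈ good g) {k : NNReal} (hk : 1 < k) :
    ∃ U ∈ 𝓝 y0, ∀ A ⊆ U ∩ good g, MeasurableSet A →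
      (Vm g).withDensity (Dn g) A ≤ (k * k : ℝ≥0∞) * (coneC n * μH[(n:ℝ) - 1] A) ∧
      coneC n * μH[(n:ℝ) - 1] A ≤ (k * k : ℝ≥0∞) * (Vm g).withDensity (Dn g) A := by
  have hk' : (1:ℝ≥0∞) < k := by exact_mod_cast hk
  obtain ⟨D0, Dt⟩ := hg.Dn_good hy
  have hlt : Dn g y0 < k * Dn g y0 := by
    conv_lhs => rw [← one_mul (Dn g y0)]
    exact ENNReal.mul_lt_mul_left D0 Dt hk'
  have hD := hg.Dn_tendsto hy
  have e1 : ∀ᶠ y in 𝓝[good g] y0, Dn g y ≤ k * Dn g y0 := hD.eventually_le_const hlt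
  have e2 : ∀ᶠ y in 𝓝[good g] y0, Dn g y0 ≤ k * Dn g y :=
    (ENNReal.Tendsto.const_mul hD (Or.inr ENNReal.coe_ne_top)).eventually_const_le hlt
  obtain ⟨W, hWo, hyW, hW⟩ := mem_nhdsWithin.1 (e1.and e2)
  obtain ⟨s, hs0, hs⟩ : ∃ s : NNReal, 0 < s ∧ kap n ‖y0‖₊ s ≤ k := by
    have h1 := (kap_tendsto n ‖y0‖₊).eventually_le_const hk'
    have h2 : ∀ᶠ s in 𝓝[>] (0:NNReal), kap n ‖y0‖₊ s ≤ k := h1.filter_mono nhdsWithin_le_nhds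
    obtain ⟨s, hs, hs'⟩ := (h2.and self_mem_nhdsWithin).exists
    exact ⟨s, hs', hs⟩
  obtain ⟨r, hr, hL⟩ := hg.lipNear hy.2 hs0
  set ξ := (InnerProductSpace.toDual ℝ (EuclideanSpace ℝ (Fin n))).symm (fderiv ℝ g y0) with hξ
  have hin : ∀ y, ⟪ξ, y⟫_ℝ = fderiv ℝ g y0 y := fun y => InnerProductSpace.toDual_symm_apply
  have hξn : ‖ξ‖ₑ = ‖fderiv ℝ g y0‖ₑ := by
    rw [← ofReal_norm, ← ofReal_norm, hξ, LinearIsometryEquiv.norm_map]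
  obtain ⟨U, hU, hUA⟩ := loc hn hg y0 ξ hy.1 (by rw [hin, hg.euler hy.2]; exact hy.1) s hs0 hr
    (by simpa only [hin] using hL)
  refine ⟨U ∩ W, inter_mem hU (hWo.mem_nhds hyW), fun A hA hAm => ?_⟩
  obtain ⟨a1, a2⟩ := hUA A (fun y hy => (hA hy).1.1) hAm (fun y hy => (hA hy).2.1)
  rw [hξn] at a1 a2
  change Dn g y0 * Vm g A ≤ _ at a1
  change _ ≤ _ * (Dn g y0 * Vm g A) at a2
  have hWA : ∀ y ∈ A, Dn g y ≤ k * Dn g y0 ∧ Dn g y0 ≤ k * Dn g y :=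
    fun y hy => hW ⟨(hA hy).1.2, (hA hy).2⟩
  rw [withDensity_apply _ hAm]
  have b1 : ∫⁻ y in A, Dn g y ∂(Vm g) ≤ k * Dn g y0 * Vm g A := by
    rw [← setLIntegral_const]
    exact setLIntegral_mono' hAm fun y hy => (hWA y hy).1
  have b2 : Dn g y0 * Vm g A ≤ k * ∫⁻ y in A, Dn g y ∂(Vm g) := by
    rw [← setLIntegral_const, ← lintegral_const_mul _ (measurable_Dn g)]
    exact setLIntegral_mono' hAm fun y hy => (hWA y hy).2
  constructor
  · calc _ ≤ k * Dn g y0 * Vm g A := b1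
      _ = k * (Dn g y0 * Vm g A) := mul_assoc _ _ _
      _ ≤ k * (kap n ‖y0‖₊ s * (coneC n * μH[(n:ℝ) - 1] A)) := by gcongr
      _ ≤ k * (k * (coneC n * μH[(n:ℝ) - 1] A)) := by gcongr
      _ = _ := (mul_assoc _ _ _).symm
  · calc _ ≤ kap n ‖y0‖₊ s * (Dn g y0 * Vm g A) := a2
      _ ≤ k * (k * ∫⁻ y in A, Dn g y ∂(Vm g)) := by gcongr
      _ = _ := (mul_assoc _ _ _).symm

lemma IsG.main {n : ℕ} (hn : 1 ≤ n) {g : EuclideanSpace ℝ (Fin n) → ℝ} (hg : IsG g) :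
    (Vm g).withDensity (Dn g) =
      coneC n • (μH[(n:ℝ) - 1] : Measure (EuclideanSpace ℝ (Fin n))).restrict {y | g y = 1} := by
  set μ2 : Measure (EuclideanSpace ℝ (Fin n)) :=
    coneC n • (μH[(n:ℝ) - 1] : Measure (EuclideanSpace ℝ (Fin n))).restrict {y | g y = 1} with hμ2
  have n1 : (Vm g).withDensity (Dn g) (good g)ᶜ = 0 :=
    withDensity_absolutelyContinuous _ _ (hg.Vm_good hn)
  have n2 : μ2 (good g)ᶜ = 0 := by
    rw [hμ2, Measure.smul_apply, Measure.restrict_apply hg.meas_good.compl]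
    have : (good g)ᶜ ∩ {y | g y = 1} = {y | g y = 1} \ good g := by
      ext y; simp [and_comm]
    rw [this, hg.haus_good hn, smul_zero]
  have hμA : ∀ A ⊆ good g, MeasurableSet A → μ2 A = coneC n * μH[(n:ℝ) - 1] A := by
    intro A hA hAm
    rw [hμ2, Measure.smul_apply, Measure.restrict_apply hAm,
      Set.inter_eq_left.2 (fun y hy => (hA hy).1), smul_eq_mul]
  ext A hA
  refine le_antisymm (le_of_kap fun k hk => ?_) (le_of_kap fun k hk => ?_)
  · refine loc2glob _ _ _ hg.meas_good n1 (fun y hy => ?_) hA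
    obtain ⟨U, hU, hUA⟩ := hg.locD hn hy hk
    refine ⟨U, hU, fun B hB hBm => ?_⟩
    rw [hμA B (fun y hy => (hB hy).2) hBm]
    exact (hUA B hB hBm).1
  · refine loc2glob _ _ _ hg.meas_good n2 (fun y hy => ?_) hA
    obtain ⟨U, hU, hUA⟩ := hg.locD hn hy hk
    refine ⟨U, hU, fun B hB hBm => ?_⟩
    rw [hμA B (fun y hy => (hB hy).2) hBm]
    exact (hUA B hB hBm).2

lemma isG_norm (n : ℕ) : IsG (fun x : EuclideanSpace ℝ (Fin n) => ‖x‖) where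
  lip := ⟨1, lipschitzWith_one_norm⟩
  pos := fun x hx => norm_pos_iff.2 hx
  hom := fun a x ha => by rw [norm_smul, Real.norm_of_nonneg ha]
  conv := convexOn_univ_norm

lemma Vm_norm {n : ℕ} (hn : 1 ≤ n) :
    Vm (fun x : EuclideanSpace ℝ (Fin n) => ‖x‖) = coneC n • sphLeb n := by
  have : Nonempty (Fin n) := ⟨⟨0, hn⟩⟩
  have hg := isG_norm n
  have h := hg.main hn
  have hs : {y : EuclideanSpace ℝ (Fin n) | ‖y‖ = 1} = sphere 0 1 := by
    ext y; simp
  rw [hs] at h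
  change _ = coneC n • sphLeb n at h
  rw [← h]
  have hae : Dn (fun x : EuclideanSpace ℝ (Fin n) => ‖x‖)
      =ᵐ[Vm (fun x : EuclideanSpace ℝ (Fin n) => ‖x‖)] 1 := by
    have h0 : ∀ᵐ y ∂(Vm (fun x : EuclideanSpace ℝ (Fin n) => ‖x‖)),
      y ∈ good (fun x : EuclideanSpace ℝ (Fin n) => ‖x‖) := hg.Vm_good hn
    filter_upwards [h0] with y hy
    have h1 : ‖y‖ = 1 := hy.1
    have h2 := norm_fderiv_norm hy.2
    unfold Dn
    rw [← ofReal_norm, ← ofReal_norm, h1, h2]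
    simp
  rw [withDensity_congr_ae hae, withDensity_one]

lemma IsG.Vm_eq {n : ℕ} (hn : 1 ≤ n) {g : EuclideanSpace ℝ (Fin n) → ℝ} (hg : IsG g) :
    Vm g = coneC n • (sphLeb n).map (prj g) := by
  rw [← Measure.map_smul, ← Vm_norm hn, Vm, Vm,
    Measure.map_map hg.measurable_prj (isG_norm n).measurable_prj]
  congr 1
  funext x
  rcases eq_or_ne x 0 with rfl | hx
  · simp [prj]
  · exact (hg.prj_smul (inv_pos.2 (norm_pos_iff.2 hx)) x).symm

lemma IsG.surf {n : ℕ} (hn : 1 ≤ n) {g : EuclideanSpace ℝ (Fin n) → ℝ} (hg : IsG g) :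
    (μH[(n:ℝ) - 1] : Measure (EuclideanSpace ℝ (Fin n))).restrict {y | g y = 1} =
      ((sphLeb n).map (prj g)).withDensity (Dn g) := by
  have h := hg.main hn
  rw [hg.Vm_eq hn, withDensity_smul_measure] at h
  ext A hA
  have hA' := congrArg (fun m : Measure (EuclideanSpace ℝ (Fin n)) => m A) h
  simp only [Measure.smul_apply, smul_eq_mul] at hA'
  exact ((ENNReal.mul_right_inj (coneC_ne_zero n) (coneC_ne_top n)).1 hA').symm

lemma IsG.ae_good {n : ℕ} (hn : 1 ≤ n) {g : EuclideanSpace ℝ (Fin n) → ℝ} (hg : IsG g) :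
    ∀ᵐ y ∂((sphLeb n).map (prj g)), y ∈ good g := by
  have h := hg.Vm_good hn
  rw [hg.Vm_eq hn, Measure.smul_apply, smul_eq_mul, mul_eq_zero] at h
  exact h.resolve_left (coneC_ne_zero n)

lemma isG_gauge {n : ℕ} {Ω : Set (EuclideanSpace ℝ (Fin n))} (hc : IsCompact Ω)
    (hv : Convex ℝ Ω) (h0 : Ω ∈ 𝓝 (0 : EuclideanSpace ℝ (Fin n))) : IsG (gauge Ω) where
  lip := hv.lipschitz_gauge h0
  pos := fun x hx => (gauge_pos (absorbent_nhds_zero h0)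
    ((NormedSpace.isVonNBounded_iff ℝ).2 hc.isBounded)).2 hx
  hom := fun a x ha => by rw [gauge_smul_of_nonneg ha, smul_eq_mul]
  conv := by
    refine ⟨convex_univ, fun x _ y _ a b ha hb _ => ?_⟩
    refine (gauge_add_le hv (absorbent_nhds_zero h0) _ _).trans ?_
    rw [gauge_smul_of_nonneg ha, gauge_smul_of_nonneg hb]

lemma radFn_eq {n : ℕ} {Ω : Set (EuclideanSpace ℝ (Fin n))} (hc : IsCompact Ω)
    (hv : Convex ℝ Ω) (h0 : Ω ∈ 𝓝 (0 : EuclideanSpace ℝ (Fin n)))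
    {v : EuclideanSpace ℝ (Fin n)} (hv0 : v ≠ 0) : radFn Ω v = (gauge Ω v)⁻¹ := by
  have hg := isG_gauge hc hv h0
  have hp := hg.pos v hv0
  have : {c : ℝ | 0 < c ∧ c • v ∈ Ω} = Set.Ioc 0 (gauge Ω v)⁻¹ := by
    ext c
    refine and_congr_right fun hc0 => ?_
    rw [← hc.isClosed.closure_eq, ← gauge_le_one_iff_mem_closure hv h0, hc.isClosed.closure_eq,
      hg.hom _ _ hc0.le, le_inv_comm₀ hc0 hp, ← one_div, le_div_iff₀ hc0, mul_comm]
  rw [radFn, this, csSup_Ioc (inv_pos.2 hp)]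

lemma normal_eq {n : ℕ} {Ω : Set (EuclideanSpace ℝ (Fin n))} (hc : IsCompact Ω)
    (hv : Convex ℝ Ω) (h0 : Ω ∈ 𝓝 (0 : EuclideanSpace ℝ (Fin n)))
    {y : EuclideanSpace ℝ (Fin n)} (hy : y ∈ good (gauge Ω)) {ξ : EuclideanSpace ℝ (Fin n)}
    (hξ : ‖ξ‖ = 1) (hs : ⟪y, ξ⟫_ℝ = suppFn Ω ξ) :
    0 < ⟪y, ξ⟫_ℝ ∧ ‖fderiv ℝ (gauge Ω) y‖ * ⟪y, ξ⟫_ℝ = 1 ∧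
      innerSL ℝ ξ = ⟪y, ξ⟫_ℝ • fderiv ℝ (gauge Ω) y := by
  have hg := isG_gauge hc hv h0
  have hle : ∀ x ∈ Ω, ⟪ξ, x⟫_ℝ ≤ ⟪y, ξ⟫_ℝ := by
    intro x hx
    rw [hs]
    refine le_csSup ?_ ⟨x, hx, rfl⟩
    exact (hc.image (by fun_prop)).bddAbove
  have hpos : 0 < ⟪y, ξ⟫_ℝ := by
    obtain ⟨ε, hε, hb⟩ := Metric.mem_nhds_iff.1 h0
    have : (ε/2) • ξ ∈ Ω := by
      apply hb
      rw [mem_ball_zero_iff, norm_smul, hξ, Real.norm_of_nonneg (by positivity)]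
      linarith
    have := hle _ this
    rw [inner_smul_right, real_inner_self_eq_norm_sq, hξ] at this
    linarith
  have hall : ∀ x, ⟪ξ, x⟫_ℝ ≤ ⟪y, ξ⟫_ℝ * gauge Ω x := by
    intro x
    rcases eq_or_ne x 0 with rfl | hx
    · simp [hg.zero]
    have h1 : prj (gauge Ω) x ∈ Ω := by
      have h2 : prj (gauge Ω) x ∈ closure Ω :=
        (gauge_le_one_iff_mem_closure hv h0).1 (hg.g_prj hx).le
      rwa [hc.isClosed.closure_eq] at h2
    have h3 := hle _ h1
    have hp := hg.pos x hx
    rw [prj, inner_smul_right, inv_mul_le_iff₀ hp] at h3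
    linarith
  have hmin : IsLocalMin (fun x => ⟪y, ξ⟫_ℝ * gauge Ω x - innerSL ℝ ξ x) y := by
    refine Eventually.of_forall fun x => ?_
    have h1 : gauge Ω y = 1 := hy.1
    have h2 := hall x
    simp only [innerSL_apply_apply, h1, mul_one, real_inner_comm y ξ, sub_self]
    linarith
  have hd : DifferentiableAt ℝ (gauge Ω) y := hy.2
  have hf := (hd.hasFDerivAt.const_mul ⟪y, ξ⟫_ℝ).sub (innerSL ℝ ξ).hasFDerivAt (x := y)
  have hz := hmin.hasFDerivAt_eq_zero hf
  have he : innerSL ℝ ξ = ⟪y, ξ⟫_ℝ • fderiv ℝ (gauge Ω) y := (sub_eq_zero.1 hz).symm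
  refine ⟨hpos, ?_, he⟩
  have := congrArg norm he
  rw [innerSL_apply_norm, hξ, norm_smul, Real.norm_of_nonneg hpos.le] at this
  rw [mul_comm]; exact this.symm

lemma normal_unique {n : ℕ} {Ω : Set (EuclideanSpace ℝ (Fin n))} (hc : IsCompact Ω)
    (hv : Convex ℝ Ω) (h0 : Ω ∈ 𝓝 (0 : EuclideanSpace ℝ (Fin n)))
    {y : EuclideanSpace ℝ (Fin n)} (hy : y ∈ good (gauge Ω)) {ξ ξ' : EuclideanSpace ℝ (Fin n)}
    (hξ : ‖ξ‖ = 1) (hs : ⟪y, ξ⟫_ℝ = suppFn Ω ξ)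
    (hξ' : ‖ξ'‖ = 1) (hs' : ⟪y, ξ'⟫_ℝ = suppFn Ω ξ') : ξ = ξ' := by
  obtain ⟨p1, e1, f1⟩ := normal_eq hc hv h0 hy hξ hs
  obtain ⟨p2, e2, f2⟩ := normal_eq hc hv h0 hy hξ' hs'
  have hne : ‖fderiv ℝ (gauge Ω) y‖ ≠ 0 := by
    intro h; rw [h] at e1; simp at e1
  have : ⟪y, ξ⟫_ℝ = ⟪y, ξ'⟫_ℝ := mul_left_cancel₀ hne (e1.trans e2.symm)
  rw [this, ← f2] at f1
  refine ext_inner_right ℝ fun w => ?_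
  have := congrArg (fun l => l w) f1
  simpa using this

/-- Boundary-integral representation of the `p`-th dual `q`-torsional measure: for every
Borel `η ⊆ S^{n-1}`,
`Q̃_{q,n-p}(Ω,η) = (b/a) ∫_{ν^{-1}(η)} ⟪y,ν(y)⟫ ‖y‖^{p-n} ‖∇u(y)‖^q dH^{n-1}(y)`. -/
theorem stmt9 (n : ℕ) (hn : 2 ≤ n) (q p : ℝ) (hq : 1 < q)
    (Ω : Set (EuclideanSpace ℝ (Fin n))) (hΩ_comp : IsCompact Ω) (hΩ_conv : Convex ℝ Ω)
    (hΩ0 : (0 : EuclideanSpace ℝ (Fin n)) ∈ interior Ω)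
    (u : EuclideanSpace ℝ (Fin n) → ℝ)
    (G : EuclideanSpace ℝ (Fin n) → EuclideanSpace ℝ (Fin n))
    (hu : IsQTorsion q Ω u G)
    (ν : EuclideanSpace ℝ (Fin n) → EuclideanSpace ℝ (Fin n))
    (hν_meas : Measurable ν)
    (hν_sph : ∀ y ∈ frontier Ω, ν y ∈ sphere (0 : EuclideanSpace ℝ (Fin n)) 1)
    (hν : ∀ᵐ y ∂((μH[(n : ℝ) - 1] : Measure (EuclideanSpace ℝ (Fin n))).restrict (frontier Ω)),
      ⟪y, ν y⟫_ℝ = suppFn Ω (ν y)) :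
    ∀ η : Set (EuclideanSpace ℝ (Fin n)), MeasurableSet η →
      η ⊆ sphere (0 : EuclideanSpace ℝ (Fin n)) 1 →
      dualTorsMeas q p Ω G η = ((q - 1) / (n * (q - 1) + q)) *
        ∫ y in frontier Ω ∩ ν ⁻¹' η,
          ⟪y, ν y⟫_ℝ * ‖y‖ ^ (p - (n : ℝ)) * ‖G y‖ ^ q ∂(μH[(n : ℝ) - 1]) := by
  intro η hη hηs
  have hn1 : 1 ≤ n := by omega
  have h0 : Ω ∈ 𝓝 (0 : EuclideanSpace ℝ (Fin n)) := mem_interior_iff_mem_nhds.1 hΩ0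
  have hg := isG_gauge hΩ_comp hΩ_conv h0
  have hlev : {y | gauge Ω y = 1} = frontier Ω := by
    ext y; exact gauge_eq_one_iff_mem_frontier hΩ_conv h0
  have hsurf := hg.surf hn1
  rw [hlev] at hsurf
  have hgood := hg.ae_good hn1
  set τ := (sphLeb n).map (prj (gauge Ω)) with hτ
  have hac : τ ≪ τ.withDensity (Dn (gauge Ω)) := by
    refine withDensity_absolutelyContinuous' (measurable_Dn _).aemeasurable ?_
    filter_upwards [hgood] with y hy
    exact (hg.Dn_good hy).1
  have hντ : ∀ᵐ y ∂τ, ⟪y, ν y⟫_ℝ = suppFn Ω (ν y) := by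
    rw [hsurf] at hν
    exact hac.ae_le hν
  have hfr : ∀ y ∈ good (gauge Ω), y ∈ frontier Ω := fun y hy => by
    rw [← hlev]; exact hy.1
  have hνη : MeasurableSet (ν ⁻¹' η) := hν_meas hη
  have hGτ : AEMeasurable G τ := by
    have h1 : τ.restrict (frontier Ω) = τ := by
      refine Measure.restrict_eq_self_of_ae_mem ?_
      filter_upwards [hgood] with y hy using hfr y hy
    rw [← h1]
    exact (hu.grad_cont.mono hΩ_comp.isClosed.frontier_subset).aemeasurable
      isClosed_frontier.measurableSet
  have hFm : AEStronglyMeasurable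
      (fun y : EuclideanSpace ℝ (Fin n) => ‖y‖ ^ p * ‖G y‖ ^ q) τ :=
    ((measurable_norm.pow_const p).aemeasurable.mul (hGτ.norm.pow_const q)).aestronglyMeasurable
  have hR : ∫ y in frontier Ω ∩ ν ⁻¹' η,
      ⟪y, ν y⟫_ℝ * ‖y‖ ^ (p - (n : ℝ)) * ‖G y‖ ^ q ∂(μH[(n : ℝ) - 1]) =
      ∫ y in ν ⁻¹' η, ‖y‖ ^ p * ‖G y‖ ^ q ∂τ := by
    rw [Set.inter_comm, ← Measure.restrict_restrict hνη, hsurf,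
      setIntegral_withDensity_eq_setIntegral_toReal_smul (measurable_Dn _) _ _ hνη]
    · refine integral_congr_ae (ae_restrict_of_ae ?_)
      filter_upwards [hgood, hντ] with y hy hyν
      have hns : ‖ν y‖ = 1 := by simpa using hν_sph y (hfr y hy)
      obtain ⟨p1, e1, -⟩ := normal_eq hΩ_comp hΩ_conv h0 hy hns hyν
      have hy0 : 0 < ‖y‖ := by
        refine norm_pos_iff.2 ?_
        rintro rfl
        simp at p1
      have hD : (Dn (gauge Ω) y).toReal = ‖fderiv ℝ (gauge Ω) y‖ * ‖y‖ ^ n := by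
        rw [Dn, ENNReal.toReal_mul, ENNReal.toReal_pow, toReal_enorm, toReal_enorm]
      rw [hD, smul_eq_mul, Real.rpow_sub hy0, Real.rpow_natCast]
      have : ‖y‖ ^ n ≠ 0 := by positivity
      calc _ = (‖fderiv ℝ (gauge Ω) y‖ * ⟪y, ν y⟫_ℝ) * ((‖y‖ ^ p / ‖y‖ ^ n * ‖y‖ ^ n) * ‖G y‖ ^ q) := by
            ring
        _ = _ := by rw [e1, div_mul_cancel₀ _ this, one_mul]
    · refine ae_restrict_of_ae ?_
      filter_upwards [hgood] with y hy
      exact (hg.Dn_good hy).2.lt_top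
  have hgood' : ∀ᵐ v ∂(sphLeb n), prj (gauge Ω) v ∈ good (gauge Ω) :=
    ae_of_ae_map hg.measurable_prj.aemeasurable hgood
  have hν' : ∀ᵐ v ∂(sphLeb n), ⟪prj (gauge Ω) v, ν (prj (gauge Ω) v)⟫_ℝ =
      suppFn Ω (ν (prj (gauge Ω) v)) :=
    ae_of_ae_map hg.measurable_prj.aemeasurable hντ
  have hsph : ∀ᵐ v ∂(sphLeb n), v ∈ sphere (0 : EuclideanSpace ℝ (Fin n)) 1 :=
    ae_restrict_mem isClosed_sphere.measurableSet
  have hrad : ∀ v ∈ sphere (0 : EuclideanSpace ℝ (Fin n)) 1,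
      radFn Ω v • v = prj (gauge Ω) v ∧ radFn Ω v = ‖prj (gauge Ω) v‖ := by
    intro v hv
    have hv1 : ‖v‖ = 1 := by simpa using hv
    have hv0 : v ≠ 0 := by rintro rfl; simp at hv1
    have hr := radFn_eq hΩ_comp hΩ_conv h0 hv0
    refine ⟨by rw [hr, prj], ?_⟩
    rw [hr, prj, norm_smul, hv1, mul_one, Real.norm_of_nonneg (inv_nonneg.2 (hg.pos v hv0).le)]
  have hset : revRadGauss Ω η =ᵐ[sphLeb n] (prj (gauge Ω) ⁻¹' (ν ⁻¹' η) : Set _) := by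
    refine eventuallyEq_set.2 ?_
    filter_upwards [hgood', hν', hsph] with v hv hvν hvs
    obtain ⟨r1, -⟩ := hrad v hvs
    have hns : ‖ν (prj (gauge Ω) v)‖ = 1 := by simpa using hν_sph _ (hfr _ hv)
    have hi : ∀ ξ, radFn Ω v * ⟪v, ξ⟫_ℝ = ⟪prj (gauge Ω) v, ξ⟫_ℝ := fun ξ => by
      rw [← r1, real_inner_smul_left]
    constructor
    · rintro ⟨-, ξ, hξη, hξ⟩
      rw [hi] at hξ
      have hξ1 : ‖ξ‖ = 1 := by simpa using hηs hξη
      have := normal_unique hΩ_comp hΩ_conv h0 hv hξ1 hξ hns hvν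
      change ν (prj (gauge Ω) v) ∈ η
      rw [← this]; exact hξη
    · intro h
      exact ⟨hvs, ν (prj (gauge Ω) v), h, by rw [hi]; exact hvν⟩
  rw [dualTorsMeas, hR, setIntegral_congr_set hset,
    setIntegral_map hνη hFm hg.measurable_prj.aemeasurable]
  congr 1
  refine integral_congr_ae (ae_restrict_of_ae ?_)
  filter_upwards [hsph] with v hv
  obtain ⟨r1, r2⟩ := hrad v hv
  rw [r1, r2]
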